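/- Let C be a skeletally small triangulated category, H a Q-subspace of G(C)_Q, and let I(H) be the set of dense triangulated subcategories D of C with image(δ^D_Q) = H, partially ordered by inclusion. Then I(H) has a unique maximal element; that is, any two maximal elements of I(H) with respect to inclusion are equal. -/

import Mathlib

open CategoryTheory CategoryTheory.Limits CategoryTheory.Pretriangulated
open scoped TensorProduct

universe v u

set_option linter.unusedSectionVars false
set_option linter.unusedVariables false

namespace GrothendieckPaper

variable (C : Type u) [Category.{v} C] [Preadditive C] [Limits.HasZeroObject C]
  [HasShift C ℤ] [∀ n : ℤ, (shiftFunctor C n).Additive] [Pretriangulated C]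

/-- The set of Euler relations `[V] - [U] - [W]` coming from distinguished triangles
`U ⟶ V ⟶ W ⟶ U⟦1⟧`. -/
def eulerSet : Set (FreeAbelianGroup C) :=
  { x | ∃ T : Triangle C, (T ∈ distTriang C) ∧
      x = FreeAbelianGroup.of T.obj₂ - FreeAbelianGroup.of T.obj₁ - FreeAbelianGroup.of T.obj₃ }

def eulerSubgroup : AddSubgroup (FreeAbelianGroup C) := AddSubgroup.closure (eulerSet C)

/-- The Grothendieck group of a (skeletally small) triangulated category. -/
def G : Type u := FreeAbelianGroup C ⧸ eulerSubgroup C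

instance : AddCommGroup (G C) := QuotientAddGroup.Quotient.addCommGroup _

/-- The class `[U]` of an object `U` in the Grothendieck group. -/
def cls (U : C) : G C := QuotientAddGroup.mk (FreeAbelianGroup.of U)

/-- A (strictly full) triangulated subcategory of `C`, given by its set of objects:
closed under isomorphisms, under the shifts `[1]` and `[-1]`, and under extensions
(cones): if `X ⟶ Y ⟶ Z ⟶ X⟦1⟧` is distinguished and `X, Y` belong then so does `Z`. -/
structure IsTriangulatedSubcat (S : Set C) : Prop where
  mem_of_iso : ∀ {X Y : C}, (X ≅ Y) → Y ∈ S → X ∈ S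
  shift_mem : ∀ {X : C}, X ∈ S → ((shiftFunctor C (1 : ℤ)).obj X) ∈ S
  shift_neg_mem : ∀ {X : C}, X ∈ S → ((shiftFunctor C (-1 : ℤ)).obj X) ∈ S
  ext_mem : ∀ (T : Triangle C), (T ∈ distTriang C) → T.obj₁ ∈ S → T.obj₂ ∈ S → T.obj₃ ∈ S

/-- `npowAux U n` is the direct sum of `n + 1` copies of `U`. -/
noncomputable def npowAux (U : C) : ℕ → C
  | 0 => U
  | n + 1 => U ⊞ npowAux U n

/-- `npow U n` is the direct sum `U^n` of `n` copies of `U` (for `n ≥ 1`;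
`npow U 0` is defined to be `U` as a junk value). -/
noncomputable def npow (U : C) (n : ℕ) : C := npowAux C U (n - 1)

/-- A subcategory (set of objects) `S` is dense in `C` if every object of `C` is a
direct summand of an object of `S`. -/
def DenseSub (S : Set C) : Prop := ∀ U : C, ∃ V : C, (U ⊞ V) ∈ S

/-- A subcategory `S` is radical if `U^n ∈ S` for some `n ≥ 1` implies `U ∈ S`. -/
def RadicalSub (S : Set C) : Prop := ∀ (U : C) (n : ℕ), 1 ≤ n → npow C U n ∈ S → U ∈ S

/-- `√S = { U | U^n ∈ S for some n ≥ 1 }`. -/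
def sqrtSet (S : Set C) : Set C := { U : C | ∃ n : ℕ, 1 ≤ n ∧ npow C U n ∈ S }

lemma subset_sqrtSet (S : Set C) : S ⊆ sqrtSet C S := fun U hU => ⟨1, le_refl 1, hU⟩

/-- The Euler relations for the full subcategory on `S`, coming from distinguished
triangles of `C` all of whose vertices lie in `S`. -/
def eulerSetSub (S : Set C) : Set (FreeAbelianGroup S) :=
  { x | ∃ (T : Triangle C) (_ : T ∈ distTriang C) (h1 : T.obj₁ ∈ S) (h2 : T.obj₂ ∈ S)
      (h3 : T.obj₃ ∈ S),
      x = FreeAbelianGroup.of (⟨T.obj₂, h2⟩ : S) - FreeAbelianGroup.of ⟨T.obj₁, h1⟩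
        - FreeAbelianGroup.of ⟨T.obj₃, h3⟩ }

/-- The Grothendieck group of the triangulated subcategory on the set of objects `S`. -/
def GSub (S : Set C) : Type u := FreeAbelianGroup S ⧸ AddSubgroup.closure (eulerSetSub C S)

instance (S : Set C) : AddCommGroup (GSub C S) := QuotientAddGroup.Quotient.addCommGroup _

lemma delta_le (S : Set C) :
    AddSubgroup.closure (eulerSetSub C S) ≤
      (eulerSubgroup C).comap (FreeAbelianGroup.map (Subtype.val : S → C)) := by
  rw [AddSubgroup.closure_le]
  rintro x ⟨T, hT, h1, h2, h3, rfl⟩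
  simp only [SetLike.mem_coe, AddSubgroup.mem_comap, map_sub, FreeAbelianGroup.map_of_apply]
  exact AddSubgroup.subset_closure ⟨T, hT, rfl⟩

/-- The natural map `δ^S : G(S) → G(C)` induced by the inclusion of the subcategory. -/
def deltaHom (S : Set C) : GSub C S →+ G C :=
  QuotientAddGroup.map _ _ (FreeAbelianGroup.map (Subtype.val : S → C)) (delta_le C S)

lemma incl_le {S S' : Set C} (h : S ⊆ S') :
    AddSubgroup.closure (eulerSetSub C S) ≤
      (AddSubgroup.closure (eulerSetSub C S')).comap
        (FreeAbelianGroup.map (Set.inclusion h)) := by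
  rw [AddSubgroup.closure_le]
  rintro x ⟨T, hT, h1, h2, h3, rfl⟩
  simp only [SetLike.mem_coe, AddSubgroup.mem_comap, map_sub, FreeAbelianGroup.map_of_apply]
  exact AddSubgroup.subset_closure ⟨T, hT, h h1, h h2, h h3, rfl⟩

/-- The map `G(S) → G(S')` induced by an inclusion `S ⊆ S'` of subcategories. -/
def inclHom {S S' : Set C} (h : S ⊆ S') : GSub C S →+ GSub C S' :=
  QuotientAddGroup.map _ _ (FreeAbelianGroup.map (Set.inclusion h)) (incl_le C h)

/-- `δ^S ⊗ ℚ : G(S)_ℚ → G(C)_ℚ`. -/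
noncomputable def deltaQ (S : Set C) : ℚ ⊗[ℤ] GSub C S →ₗ[ℚ] ℚ ⊗[ℤ] G C :=
  LinearMap.baseChange ℚ (deltaHom C S).toIntLinearMap

/-- The rationalization of the map induced by an inclusion of subcategories. -/
noncomputable def inclQ {S S' : Set C} (h : S ⊆ S') :
    ℚ ⊗[ℤ] GSub C S →ₗ[ℚ] ℚ ⊗[ℤ] GSub C S' :=
  LinearMap.baseChange ℚ (inclHom C h).toIntLinearMap

/-- The collection `I(H)` of dense triangulated subcategories `S` of `C` with
`image(δ^S_ℚ) = H`. -/
def denseFamily (H : Submodule ℚ (ℚ ⊗[ℤ] G C)) : Set (Set C) :=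
  { S | IsTriangulatedSubcat C S ∧ DenseSub C S ∧ LinearMap.range (deltaQ C S) = H }


open scoped ZeroObject

variable {C} in
lemma cls_obj₂ (T : Triangle C) (hT : T ∈ distTriang C) :
    cls C T.obj₂ = cls C T.obj₁ + cls C T.obj₃ := by
  have h : (QuotientAddGroup.mk' (eulerSubgroup C)) (FreeAbelianGroup.of T.obj₂ -
      FreeAbelianGroup.of T.obj₁ - FreeAbelianGroup.of T.obj₃) = 0 :=
    (QuotientAddGroup.eq_zero_iff _).2 (AddSubgroup.subset_closure ⟨T, hT, rfl⟩)
  rw [map_sub, map_sub, sub_sub, sub_eq_zero] at h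
  exact h

lemma cls_zero : cls C (0 : C) = 0 := by
  simpa using cls_obj₂ _ (contractible_distinguished (0 : C))

variable {C} in
lemma cls_biprod (X Y : C) : cls C (X ⊞ Y) = cls C X + cls C Y :=
  cls_obj₂ _ (binaryBiproductTriangle_distinguished X Y)

variable {C} in
lemma cls_eq_of_iso {X Y : C} (e : X ≅ Y) : cls C X = cls C Y := by
  have h := cls_obj₂ (Triangle.mk e.hom (0 : Y ⟶ 0) 0)
    (isomorphic_distinguished _ (contractible_distinguished Y) _
      (Triangle.isoMk _ _ e (Iso.refl Y) (Iso.refl 0)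
        rfl (zero_comp.trans comp_zero.symm) (zero_comp.trans comp_zero.symm)))
  simpa [cls_zero] using h.symm

variable {C} in
lemma cls_shift (X : C) : cls C ((shiftFunctor C (1 : ℤ)).obj X) = -cls C X := by
  have h := cls_obj₂ _ (rot_of_distTriang _ (contractible_distinguished X))
  exact (neg_eq_of_add_eq_zero_right (h.symm.trans (cls_zero C))).symm

variable {C} in
lemma cls_shift_neg (X : C) : cls C ((shiftFunctor C (-1 : ℤ)).obj X) = -cls C X := by
  rw [← neg_eq_iff_eq_neg, ← cls_shift]
  exact cls_eq_of_iso ((shiftFunctorCompIsoId C (-1 : ℤ) 1 (by norm_num)).app X)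

lemma cls_surjective : Function.Surjective (cls C) := by
  intro g
  obtain ⟨x, rfl⟩ := QuotientAddGroup.mk_surjective g
  induction x using FreeAbelianGroup.induction_on with
  | zero => exact ⟨0, cls_zero C⟩
  | of X => exact ⟨X, rfl⟩
  | neg X _ => exact ⟨_, cls_shift X⟩
  | add x y hx hy =>
    obtain ⟨X, hX⟩ := hx
    obtain ⟨Y, hY⟩ := hy
    refine ⟨X ⊞ Y, ?_⟩
    rw [cls_biprod, hX, hY]
    rfl

lemma exists_zsmul_eq_one_tmul {M : Type*} [AddCommGroup M] (x : ℚ ⊗[ℤ] M) :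
    ∃ n : ℤ, n ≠ 0 ∧ ∃ m : M, n • x = 1 ⊗ₜ m := by
  induction x with
  | zero => exact ⟨1, one_ne_zero, 0, by simp⟩
  | tmul q m =>
    refine ⟨q.den, by simp, q.num • m, ?_⟩
    rw [TensorProduct.smul_tmul', TensorProduct.tmul_smul, TensorProduct.smul_tmul']
    congr 1
    simp [mul_comm]
  | add x y hx hy =>
    obtain ⟨a, ha, m, hm⟩ := hx
    obtain ⟨b, hb, k, hk⟩ := hy
    refine ⟨a * b, mul_ne_zero ha hb, b • m + a • k, ?_⟩
    rw [TensorProduct.tmul_add, TensorProduct.tmul_smul, TensorProduct.tmul_smul, ← hm, ← hk,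
      smul_add, smul_smul, smul_smul, mul_comm b a]

/-- The quotient map onto the Grothendieck group of a subcategory. -/
def gSubMk (S : Set C) : FreeAbelianGroup S →+ GSub C S := QuotientAddGroup.mk' _

lemma gSubMk_surjective (S : Set C) : Function.Surjective (gSubMk C S) :=
  QuotientAddGroup.mk'_surjective _

lemma deltaHom_gSubMk_of (S : Set C) (U : S) :
    deltaHom C S (gSubMk C S (FreeAbelianGroup.of U)) = cls C U := rfl

lemma deltaQ_tmul (S : Set C) (q : ℚ) (g : GSub C S) :
    deltaQ C S (q ⊗ₜ g) = q ⊗ₜ deltaHom C S g := rfl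

variable {C} in
lemma one_tmul_cls_mem_range {S : Set C} {U : C} (hU : U ∈ S) :
    (1 : ℚ) ⊗ₜ[ℤ] cls C U ∈ LinearMap.range (deltaQ C S) :=
  ⟨1 ⊗ₜ gSubMk C S (FreeAbelianGroup.of ⟨U, hU⟩), by rw [deltaQ_tmul, deltaHom_gSubMk_of]⟩

variable {C} in
lemma range_deltaQ_le {S : Set C} {H : Submodule ℚ (ℚ ⊗[ℤ] G C)}
    (h : ∀ U ∈ S, (1 : ℚ) ⊗ₜ[ℤ] cls C U ∈ H) : LinearMap.range (deltaQ C S) ≤ H := by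
  have key (g : GSub C S) : (1 : ℚ) ⊗ₜ[ℤ] deltaHom C S g ∈ H := by
    obtain ⟨x, rfl⟩ := gSubMk_surjective C S g
    induction x using FreeAbelianGroup.induction_on with
    | zero => simp
    | of X => exact h X X.2
    | neg X hX =>
      rw [map_neg, map_neg, TensorProduct.tmul_neg]
      exact H.neg_mem hX
    | add x y hx hy =>
      rw [map_add, map_add, TensorProduct.tmul_add]
      exact H.add_mem hx hy
  rintro _ ⟨x, rfl⟩
  induction x with
  | zero => simp
  | tmul q g =>
    have hq := H.smul_mem q (key g)
    rwa [TensorProduct.smul_tmul', smul_eq_mul, mul_one] at hq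
  | add x y hx hy =>
    rw [map_add]
    exact H.add_mem hx hy

/-- The objects of `C` whose rational class lies in `H`. -/
def objectsOver (H : Submodule ℚ (ℚ ⊗[ℤ] G C)) : Set C :=
  { U | (1 : ℚ) ⊗ₜ[ℤ] cls C U ∈ H }

lemma isTriangulatedSubcat_objectsOver (H : Submodule ℚ (ℚ ⊗[ℤ] G C)) :
    IsTriangulatedSubcat C (objectsOver C H) where
  mem_of_iso e hY := by
    simpa only [objectsOver, Set.mem_ofPred_eq, cls_eq_of_iso e] using hY
  shift_mem hX := by
    simpa only [objectsOver, Set.mem_ofPred_eq, cls_shift, TensorProduct.tmul_neg, neg_mem_iff]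
      using hX
  shift_neg_mem hX := by
    simpa only [objectsOver, Set.mem_ofPred_eq, cls_shift_neg, TensorProduct.tmul_neg, neg_mem_iff]
      using hX
  ext_mem T hT h₁ h₂ := by
    have h := H.sub_mem h₂ h₁
    rwa [cls_obj₂ T hT, TensorProduct.tmul_add, add_sub_cancel_left] at h

lemma denseSub_objectsOver (H : Submodule ℚ (ℚ ⊗[ℤ] G C)) : DenseSub C (objectsOver C H) := by
  intro U
  refine ⟨(shiftFunctor C (1 : ℤ)).obj U, ?_⟩
  rw [objectsOver, Set.mem_ofPred_eq, cls_biprod, cls_shift, add_neg_cancel,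
    TensorProduct.tmul_zero]
  exact H.zero_mem

lemma range_deltaQ_objectsOver (H : Submodule ℚ (ℚ ⊗[ℤ] G C)) :
    LinearMap.range (deltaQ C (objectsOver C H)) = H := by
  refine le_antisymm (range_deltaQ_le fun U hU => hU) fun x hx => ?_
  obtain ⟨n, hn, g, hg⟩ := exists_zsmul_eq_one_tmul x
  obtain ⟨U, rfl⟩ := cls_surjective C g
  have hU : U ∈ objectsOver C H := by
    rw [objectsOver, Set.mem_ofPred_eq, ← hg]
    exact zsmul_mem hx n
  have h := one_tmul_cls_mem_range hU
  rw [← hg, ← Int.cast_smul_eq_zsmul ℚ] at h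
  exact (Submodule.smul_mem_iff _ (Int.cast_ne_zero.2 hn)).1 h

/-- `objectsOver C H` is the greatest element of `I(H)`. -/
lemma isGreatest_objectsOver (H : Submodule ℚ (ℚ ⊗[ℤ] G C)) :
    IsGreatest (denseFamily C H) (objectsOver C H) := by
  refine ⟨⟨isTriangulatedSubcat_objectsOver C H, denseSub_objectsOver C H,
    range_deltaQ_objectsOver C H⟩, ?_⟩
  rintro S ⟨-, -, rfl⟩ U hU
  exact one_tmul_cls_mem_range hU

/-- `I(H)` has a unique maximal element: there is a maximal element, and any
two maximal elements of `I(H)` with respect to inclusion coincide. -/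
theorem denseFamily_unique_maximal (H : Submodule ℚ (ℚ ⊗[ℤ] G C)) :
    ∃! S : Set C, S ∈ denseFamily C H ∧ ∀ S' ∈ denseFamily C H, S ⊆ S' → S' = S := by
  obtain ⟨hmem, hub⟩ := isGreatest_objectsOver C H
  refine ⟨objectsOver C H, ⟨hmem, fun S hS h => Set.Subset.antisymm (hub hS) h⟩, ?_⟩
  rintro S ⟨hS, hmax⟩
  exact (hmax _ hmem (hub hS)).symm


end GrothendieckPaper
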